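/- Let f : S¹ → S¹ be a continuous map and let x be an isolated point of S(f), i.e., x ∈ S(f) and there is an open set N ⊆ S¹ with N ∩ S(f) = {x}. Then f has either a local maximum at x or a local minimum at x. -/

import Mathlib

open Set Topology

/-- The circle `S¹ = ℝ / ℤ`. -/
abbrev Circle1 : Type := AddCircle (1 : ℝ)

/-- A point `x ∈ S¹` is a *regular point* of `f : S¹ → S¹` if there is a connected
open set `N ⊆ S¹` with `x ∈ N` such that the restriction of `f` to `N` is a
topological embedding. -/
def IsRegularPt (f : Circle1 → Circle1) (x : Circle1) : Prop :=
  ∃ N : Set Circle1, IsOpen N ∧ IsConnected N ∧ x ∈ N ∧ Topology.IsEmbedding (N.restrict f)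

/-- `R(f)`, the set of regular points of `f`. -/
def RegularPts (f : Circle1 → Circle1) : Set Circle1 := {x | IsRegularPt f x}

/-- `S(f) = S¹ \ R(f)`, the set of singular points of `f`. -/
def SingularPts (f : Circle1 → Circle1) : Set Circle1 := univ \ RegularPts f

/-- `f` is *increasing at* `x`: `x` is a regular point, and there exist `a ∈ ℝ` with
`π a = x`, `ε > 0`, and a continuous `g : ℝ → ℝ` strictly increasing on `(a-ε, a+ε)`
with `f (π t) = π (g t)` for all `t ∈ (a-ε, a+ε)`. -/
def IncreasingAt (f : Circle1 → Circle1) (x : Circle1) : Prop :=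
  IsRegularPt f x ∧ ∃ a : ℝ, (a : Circle1) = x ∧ ∃ ε : ℝ, 0 < ε ∧ ∃ g : ℝ → ℝ,
    Continuous g ∧ StrictMonoOn g (Ioo (a - ε) (a + ε)) ∧
    ∀ t ∈ Ioo (a - ε) (a + ε), f (t : Circle1) = ((g t : ℝ) : Circle1)

/-- `f` is *decreasing at* `x`: as `IncreasingAt`, with `g` strictly decreasing. -/
def DecreasingAt (f : Circle1 → Circle1) (x : Circle1) : Prop :=
  IsRegularPt f x ∧ ∃ a : ℝ, (a : Circle1) = x ∧ ∃ ε : ℝ, 0 < ε ∧ ∃ g : ℝ → ℝ,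
    Continuous g ∧ StrictAntiOn g (Ioo (a - ε) (a + ε)) ∧
    ∀ t ∈ Ioo (a - ε) (a + ε), f (t : Circle1) = ((g t : ℝ) : Circle1)

/-- `R₊(f)`, the set of points at which `f` is increasing. -/
def RPlus (f : Circle1 → Circle1) : Set Circle1 := {x | IncreasingAt f x}

/-- `R₋(f)`, the set of points at which `f` is decreasing. -/
def RMinus (f : Circle1 → Circle1) : Set Circle1 := {x | DecreasingAt f x}

/-- `f` has a *local maximum* at `x`: there are `a ∈ ℝ` with `π a = x` and
`ε ∈ (0, 1/2)` such that `π '' (a-ε, a) ⊆ R₊(f)` and `π '' (a, a+ε) ⊆ R₋(f)`. -/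
def HasLocalMaxAt (f : Circle1 → Circle1) (x : Circle1) : Prop :=
  ∃ a : ℝ, (a : Circle1) = x ∧ ∃ ε ∈ Ioo (0 : ℝ) (1 / 2),
    (fun t : ℝ => ((t : ℝ) : Circle1)) '' Ioo (a - ε) a ⊆ RPlus f ∧
    (fun t : ℝ => ((t : ℝ) : Circle1)) '' Ioo a (a + ε) ⊆ RMinus f

/-- `f` has a *local minimum* at `x`: there are `a ∈ ℝ` with `π a = x` and
`ε ∈ (0, 1/2)` such that `π '' (a-ε, a) ⊆ R₋(f)` and `π '' (a, a+ε) ⊆ R₊(f)`. -/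
def HasLocalMinAt (f : Circle1 → Circle1) (x : Circle1) : Prop :=
  ∃ a : ℝ, (a : Circle1) = x ∧ ∃ ε ∈ Ioo (0 : ℝ) (1 / 2),
    (fun t : ℝ => ((t : ℝ) : Circle1)) '' Ioo (a - ε) a ⊆ RMinus f ∧
    (fun t : ℝ => ((t : ℝ) : Circle1)) '' Ioo a (a + ε) ⊆ RPlus f

/-- A continuous real function which is injective near `t` has no local extremum at `t`. -/
theorem not_isLocalExtr_of_injOn {F : ℝ → ℝ} (hF : Continuous F) {t : ℝ} {U : Set ℝ}
    (hU : U ∈ 𝓝 t) (hinj : InjOn F U) : ¬ IsLocalExtr F t := by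
  intro hext
  rcases hext with h | h
  all_goals
    obtain ⟨δ, hδ, hsub⟩ := Metric.mem_nhds_iff.1 (Filter.inter_mem hU h)
    rw [Real.ball_eq_Ioo] at hsub
    have hm := hF.continuousOn.strictMonoOn_of_injOn_Ioo (by linarith : t - δ < t + δ)
      (hinj.mono fun s hs => (hsub hs).1)
    have hl : t - δ / 2 ∈ Ioo (t - δ) (t + δ) := ⟨by linarith, by linarith⟩
    have hc : t ∈ Ioo (t - δ) (t + δ) := ⟨by linarith, by linarith⟩
    have hr : t + δ / 2 ∈ Ioo (t - δ) (t + δ) := ⟨by linarith, by linarith⟩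
    have h1 := (hsub hl).2
    have h2 := (hsub hr).2
    simp only [mem_ofPred_eq] at h1 h2
    rcases hm with hm | hm
    all_goals
      have h3 := hm hl hc (by linarith)
      have h4 := hm hc hr (by linarith)
      linarith

/-- A continuous real function without local extrema on an open interval is injective there. -/
theorem injOn_Ioo_of_not_isLocalExtr {F : ℝ → ℝ} (hF : Continuous F) {b c : ℝ}
    (h : ∀ t ∈ Ioo b c, ¬ IsLocalExtr F t) : InjOn F (Ioo b c) := by
  have key : ∀ s ∈ Ioo b c, ∀ t ∈ Ioo b c, s < t → F s ≠ F t := by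
    intro s hs t ht hst heq
    obtain ⟨u, hu, hext⟩ := exists_isLocalExtr_Ioo hst hF.continuousOn heq
    exact h u ⟨hs.1.trans hu.1, hu.2.trans ht.2⟩ hext
  intro s hs t ht heq
  by_contra hne
  rcases lt_or_gt_of_ne hne with hlt | hlt
  · exact key s hs t ht hlt heq
  · exact key t ht s hs hlt heq.symm

/-- A continuous real function which is injective to the left of a local maximum is strictly
increasing there. -/
theorem strictMonoOn_Ioo_of_isLocalMax {F : ℝ → ℝ} (hF : Continuous F) {a b : ℝ} (hb : b < a)
    (hmax : IsLocalMax F a) (hinj : InjOn F (Ioo b a)) : StrictMonoOn F (Ioo b a) := by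
  refine (hF.continuousOn.strictMonoOn_of_injOn_Ioo hb hinj).resolve_right fun hanti => ?_
  have hev : ∀ᶠ s in 𝓝[<] a, F s ≤ F a ∧ s ∈ Ioo b a :=
    (hmax.filter_mono nhdsWithin_le_nhds).and (Ioo_mem_nhdsLT hb)
  obtain ⟨s, hs, hsI⟩ := hev.exists
  obtain ⟨u, hsu, hua⟩ := exists_between hsI.2
  have huI : u ∈ Ioo b a := ⟨hsI.1.trans hsu, hua⟩
  have hle : F a ≤ F u := by
    refine le_of_tendsto (hF.continuousAt.tendsto.mono_left (nhdsWithin_le_nhds (s := Iio a))) ?_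
    filter_upwards [Ioo_mem_nhdsLT hua] with v hv
    exact (hanti huI ⟨huI.1.trans hv.1, hv.2⟩ hv.1).le
  linarith [hanti hsI huI hsu]

/-- A continuous real function which is injective to the right of a local maximum is strictly
decreasing there. -/
theorem strictAntiOn_Ioo_of_isLocalMax {F : ℝ → ℝ} (hF : Continuous F) {a c : ℝ} (hc : a < c)
    (hmax : IsLocalMax F a) (hinj : InjOn F (Ioo a c)) : StrictAntiOn F (Ioo a c) := by
  have hmem : ∀ s ∈ Ioo (-c) (-a), -s ∈ Ioo a c := fun s hs =>
    ⟨by linarith [hs.2], by linarith [hs.1]⟩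
  have hmax' : IsLocalMax (fun s => F (-s)) (-a) := by
    have ht : Filter.Tendsto (fun s : ℝ => -s) (𝓝 (-a)) (𝓝 a) := by
      simpa using (continuous_neg (G := ℝ)).tendsto (-a)
    simpa [IsLocalMax, IsMaxFilter] using ht.eventually hmax
  have hmono := strictMonoOn_Ioo_of_isLocalMax (F := fun s => F (-s)) (by fun_prop)
    (neg_lt_neg hc) hmax' fun s hs t ht heq => neg_injective (hinj (hmem s hs) (hmem t ht) heq)
  intro s hs t ht hst
  simpa using hmono (a := -t) ⟨by linarith [ht.2], by linarith [ht.1]⟩ (b := -s)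
    ⟨by linarith [hs.2], by linarith [hs.1]⟩ (by linarith)

/-- A continuous self-map of the circle lifts to a continuous self-map of the line. -/
theorem exists_continuous_lift {f : Circle1 → Circle1} (hf : Continuous f) :
    ∃ F : ℝ → ℝ, Continuous F ∧ ∀ t : ℝ, f (t : Circle1) = ((F t : ℝ) : Circle1) := by
  obtain ⟨e, he⟩ := QuotientAddGroup.mk_surjective (f ((0 : ℝ) : Circle1))
  obtain ⟨F, ⟨-, hF⟩, -⟩ := (AddCircle.isCoveringMap_coe (1 : ℝ)).existsUnique_continuousMap_lifts
    ⟨fun t : ℝ => f (t : Circle1), hf.comp (AddCircle.continuous_mk' 1)⟩ 0 e he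
  exact ⟨F, F.continuous, fun t => (congrFun hF t).symm⟩

/-- The quotient map `ℝ → S¹` is injective on open intervals of length one. -/
theorem injOn_coe_ball (t : ℝ) :
    InjOn (fun s : ℝ => (s : Circle1)) (Metric.ball t (1 / 2)) := by
  intro s hs u hu h
  rw [Real.ball_eq_Ioo] at hs hu
  exact (AddCircle.coe_eq_coe_iff_of_mem_Ico (p := (1 : ℝ)) (a := t - 1 / 2)
    ⟨hs.1.le, by linarith [hs.2]⟩ ⟨hu.1.le, by linarith [hu.2]⟩).1 h

/-- The point `π t` is regular for `f` exactly when a lift of `f` is injective near `t`. -/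
theorem isRegularPt_coe_iff {f : Circle1 → Circle1} (hf : Continuous f) {F : ℝ → ℝ}
    (hF : Continuous F) (hfF : ∀ t : ℝ, f (t : Circle1) = ((F t : ℝ) : Circle1)) (t : ℝ) :
    IsRegularPt f (t : Circle1) ↔ ∃ U ∈ 𝓝 t, InjOn F U := by
  have hπ : Continuous (fun s : ℝ => (s : Circle1)) := AddCircle.continuous_mk' 1
  constructor
  · rintro ⟨N, hN, -, htN, hemb⟩
    refine ⟨_, Filter.inter_mem ((hN.preimage hπ).mem_nhds htN)
      (Metric.ball_mem_nhds t (by norm_num : (0 : ℝ) < 1 / 2)), ?_⟩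
    intro s hs u hu h
    refine injOn_coe_ball t hs.2 hu.2 (injOn_iff_injective.2 hemb.injective hs.1 hu.1 ?_)
    rw [hfF, hfF, h]
  · rintro ⟨U, hU, hinj⟩
    have hV : U ∩ Metric.ball t (1 / 2) ∩ F ⁻¹' Metric.ball (F t) (1 / 2) ∈ 𝓝 t :=
      Filter.inter_mem (Filter.inter_mem hU (Metric.ball_mem_nhds t (by norm_num)))
        (hF.continuousAt.preimage_mem_nhds (Metric.ball_mem_nhds _ (by norm_num)))
    obtain ⟨δ, hδ, hsub⟩ := Metric.nhds_basis_closedBall.mem_iff.1 hV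
    have hinjK : InjOn f ((fun s : ℝ => (s : Circle1)) '' Metric.closedBall t δ) := by
      rintro _ ⟨s, hs, rfl⟩ _ ⟨u, hu, rfl⟩ h
      simp only [hfF] at h
      have : s = u := hinj (hsub hs).1.1 (hsub hu).1.1
        (injOn_coe_ball (F t) (hsub hs).2 (hsub hu).2 h)
      rw [this]
    set K := (fun s : ℝ => (s : Circle1)) '' Metric.closedBall t δ
    have hKc : IsCompact K := (isCompact_closedBall t δ).image hπ
    have : CompactSpace K := isCompact_iff_compactSpace.1 hKc
    have hembK : IsEmbedding (K.restrict f) :=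
      ((hf.comp continuous_subtype_val).isClosedEmbedding (injOn_iff_injective.1 hinjK)).isEmbedding
    have hNK : (fun s : ℝ => (s : Circle1)) '' Metric.ball t δ ⊆ K :=
      image_mono Metric.ball_subset_closedBall
    refine ⟨(fun s : ℝ => (s : Circle1)) '' Metric.ball t δ,
      QuotientAddGroup.isOpenMap_coe _ Metric.isOpen_ball, ?_,
      ⟨t, Metric.mem_ball_self hδ, rfl⟩, hembK.comp (IsEmbedding.inclusion hNK)⟩
    rw [Real.ball_eq_Ioo]
    exact (isConnected_Ioo (by linarith)).image _ hπ.continuousOn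

theorem exists_Ioo_subset_Ioo {b c t : ℝ} (ht : t ∈ Ioo b c) :
    ∃ ε > 0, Ioo (t - ε) (t + ε) ⊆ Ioo b c := by
  obtain ⟨ε, hε, hsub⟩ := Metric.mem_nhds_iff.1 (isOpen_Ioo.mem_nhds ht)
  exact ⟨ε, hε, by rwa [← Real.ball_eq_Ioo]⟩

/-- Where a lift of `f` is strictly increasing, `f` is increasing at every point. -/
theorem image_subset_RPlus {f : Circle1 → Circle1} (hf : Continuous f) {F : ℝ → ℝ}
    (hF : Continuous F) (hfF : ∀ t : ℝ, f (t : Circle1) = ((F t : ℝ) : Circle1)) {b c : ℝ}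
    (hmono : StrictMonoOn F (Ioo b c)) :
    (fun t : ℝ => ((t : ℝ) : Circle1)) '' Ioo b c ⊆ RPlus f := by
  rintro _ ⟨t, ht, rfl⟩
  obtain ⟨ε, hε, hsub⟩ := exists_Ioo_subset_Ioo ht
  exact ⟨(isRegularPt_coe_iff hf hF hfF t).2 ⟨_, isOpen_Ioo.mem_nhds ht, hmono.injOn⟩,
    t, rfl, ε, hε, F, hF, hmono.mono hsub, fun s _ => hfF s⟩

/-- Where a lift of `f` is strictly decreasing, `f` is decreasing at every point. -/
theorem image_subset_RMinus {f : Circle1 → Circle1} (hf : Continuous f) {F : ℝ → ℝ}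
    (hF : Continuous F) (hfF : ∀ t : ℝ, f (t : Circle1) = ((F t : ℝ) : Circle1)) {b c : ℝ}
    (hanti : StrictAntiOn F (Ioo b c)) :
    (fun t : ℝ => ((t : ℝ) : Circle1)) '' Ioo b c ⊆ RMinus f := by
  rintro _ ⟨t, ht, rfl⟩
  obtain ⟨ε, hε, hsub⟩ := exists_Ioo_subset_Ioo ht
  exact ⟨(isRegularPt_coe_iff hf hF hfF t).2 ⟨_, isOpen_Ioo.mem_nhds ht, hanti.injOn⟩,
    t, rfl, ε, hε, F, hF, hanti.mono hsub, fun s _ => hfF s⟩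

/-- If `f : S¹ → S¹` is continuous and `x` is an isolated point of the singular set
`S(f)`, then `f` has either a local maximum or a local minimum at `x`. -/
theorem localMax_or_localMin_of_isolated_singular (f : Circle1 → Circle1)
    (hf : Continuous f) (x : Circle1) (hx : x ∈ SingularPts f)
    (hiso : ∃ N : Set Circle1, IsOpen N ∧ N ∩ SingularPts f = {x}) :
    HasLocalMaxAt f x ∨ HasLocalMinAt f x := by
  obtain ⟨F, hF, hfF⟩ := exists_continuous_lift hf
  obtain ⟨a, rfl⟩ := QuotientAddGroup.mk_surjective x
  obtain ⟨N, hN, hNS⟩ := hiso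
  have haN : (a : Circle1) ∈ N := (hNS.symm ▸ mem_singleton (a : Circle1) :
    (a : Circle1) ∈ N ∩ SingularPts f).1
  obtain ⟨δ, hδ, hsub⟩ := Metric.mem_nhds_iff.1
    ((hN.preimage (AddCircle.continuous_mk' (1 : ℝ))).mem_nhds haN)
  obtain ⟨ε, hε, hεδ⟩ := exists_between (lt_min hδ (by norm_num : (0 : ℝ) < 1 / 2))
  have hε2 : ε < 1 / 2 := hεδ.trans_le (min_le_right _ _)
  have hεδ : ε < δ := hεδ.trans_le (min_le_left _ _)
  have hnext : ∀ t ∈ Ioo (a - ε) (a + ε), t ≠ a → ¬ IsLocalExtr F t := by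
    intro t ht hta
    have hreg : IsRegularPt f (t : Circle1) := by
      by_contra hsing
      have hmem : (t : Circle1) ∈ N ∩ SingularPts f :=
        ⟨hsub (by rw [Real.ball_eq_Ioo]; exact ⟨by linarith [ht.1], by linarith [ht.2]⟩),
          mem_univ _, hsing⟩
      rw [hNS] at hmem
      refine hta (injOn_coe_ball a ?_ (Metric.mem_ball_self (by norm_num)) hmem)
      rw [Real.ball_eq_Ioo]
      exact ⟨by linarith [ht.1], by linarith [ht.2]⟩
    obtain ⟨U, hU, hinj⟩ := (isRegularPt_coe_iff hf hF hfF t).1 hreg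
    exact not_isLocalExtr_of_injOn hF hU hinj
  have hext : IsLocalExtr F a := by
    by_contra hna
    refine hx.2 ((isRegularPt_coe_iff hf hF hfF a).2 ⟨_, Ioo_mem_nhds (by linarith) (by linarith),
      injOn_Ioo_of_not_isLocalExtr (b := a - ε) (c := a + ε) hF fun t ht => ?_⟩)
    rcases eq_or_ne t a with rfl | hta
    exacts [hna, hnext t ht hta]
  have hleft : InjOn F (Ioo (a - ε) a) := injOn_Ioo_of_not_isLocalExtr hF fun t ht =>
    hnext t ⟨ht.1, by linarith [ht.2]⟩ ht.2.ne
  have hright : InjOn F (Ioo a (a + ε)) := injOn_Ioo_of_not_isLocalExtr hF fun t ht =>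
    hnext t ⟨by linarith [ht.1], ht.2⟩ ht.1.ne'
  have hla : a - ε < a := by linarith
  have har : a < a + ε := by linarith
  rcases hext with hmin | hmax
  · right
    refine ⟨a, rfl, ε, ⟨hε, hε2⟩, image_subset_RMinus hf hF hfF ?_, image_subset_RPlus hf hF hfF ?_⟩
    · simpa using (strictMonoOn_Ioo_of_isLocalMax hF.neg hla hmin.neg
        fun s hs t ht h => hleft hs ht (neg_injective h)).neg
    · simpa using (strictAntiOn_Ioo_of_isLocalMax hF.neg har hmin.neg
        fun s hs t ht h => hright hs ht (neg_injective h)).neg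
  · left
    exact ⟨a, rfl, ε, ⟨hε, hε2⟩,
      image_subset_RPlus hf hF hfF (strictMonoOn_Ioo_of_isLocalMax hF hla hmax hleft),
      image_subset_RMinus hf hF hfF (strictAntiOn_Ioo_of_isLocalMax hF har hmax hright)⟩
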